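/- Let R be a Cohen–Macaulay local ring of dimension d > 0 with canonical module ω such that R_p is Gorenstein for every prime p of height at most 1. If Ext^i_R(ω, R) = 0 for all 1 ≤ i ≤ 2d−1, then R is Gorenstein. -/

import Mathlib

open CategoryTheory TensorProduct IsLocalRing

noncomputable section

/-- The `n`-th Ext group of two `R`-modules. -/
abbrev extGroup (R : Type) [CommRing R] (n : ℕ) (M N : Type) [AddCommGroup M] [Module R M]
    [AddCommGroup N] [Module R N] : Type :=
  ((Ext R (ModuleCat R) n).obj (Opposite.op (ModuleCat.of R M))).obj (ModuleCat.of R N)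

/-- The `n`-th Tor group of two `R`-modules. -/
abbrev torGroup (R : Type) [CommRing R] (n : ℕ) (M N : Type) [AddCommGroup M] [Module R M]
    [AddCommGroup N] [Module R N] : Type :=
  ((Tor (ModuleCat R) n).obj (ModuleCat.of R M)).obj (ModuleCat.of R N)

/-- The depth of a module over a local ring, as the infimum of the degrees in which
`Ext(k, N)` is nonzero. -/
def moduleDepth (R : Type) [CommRing R] [IsLocalRing R] (N : Type) [AddCommGroup N]
    [Module R N] : ℕ∞ :=
  sInf {n : ℕ∞ | ∃ k : ℕ, n = k ∧
    Nontrivial (extGroup R k (R ⧸ IsLocalRing.maximalIdeal R) N)}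

/-- A module is maximal Cohen–Macaulay if `depth M_p = dim R_p` for all `p` in the support. -/
def IsMCM (R : Type) [CommRing R] (M : Type) [AddCommGroup M] [Module R M] : Prop :=
  ∀ p : PrimeSpectrum R, Nontrivial (LocalizedModule p.asIdeal.primeCompl M) →
    (moduleDepth (Localization.AtPrime p.asIdeal)
        (LocalizedModule p.asIdeal.primeCompl M) : WithBot ℕ∞) =
      ringKrullDim (Localization.AtPrime p.asIdeal)

/-- A local ring is Cohen–Macaulay if its depth equals its Krull dimension. -/
def IsCMLocal (R : Type) [CommRing R] [IsLocalRing R] : Prop :=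
  (moduleDepth R R : WithBot ℕ∞) = ringKrullDim R

/-- Injective dimension at most `n`, defined recursively via cosyzygies. -/
def hasInjDimLE (R : Type) [CommRing R] : ℕ → ∀ (M : Type) [AddCommGroup M] [Module R M], Prop
  | 0, M, _, _ => Module.Injective R M
  | (n+1), M, _, _ => ∃ (I : Type) (_ : AddCommGroup I) (_ : Module R I) (f : M →ₗ[R] I),
      Module.Injective R I ∧ Function.Injective f ∧
        hasInjDimLE R n (I ⧸ LinearMap.range f)

/-- Projective dimension at most `n`, defined recursively via syzygies. -/
def hasPdLE (R : Type) [CommRing R] : ℕ → ∀ (M : Type) [AddCommGroup M] [Module R M], Prop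
  | 0, M, _, _ => Module.Projective R M
  | (n+1), M, _, _ => ∃ (P : Type) (_ : AddCommGroup P) (_ : Module R P) (f : P →ₗ[R] M),
      Module.Projective R P ∧ Function.Surjective f ∧ hasPdLE R n (LinearMap.ker f)

/-- `ω` is a canonical module of the Cohen–Macaulay local ring `R`: it is finitely generated,
maximal Cohen–Macaulay, of finite injective dimension, and of type one. -/
def IsCanonicalModule (R : Type) [CommRing R] [IsLocalRing R] (ω : Type) [AddCommGroup ω]
    [Module R ω] : Prop :=
  Module.Finite R ω ∧ IsMCM R ω ∧ (∃ n, hasInjDimLE R n ω) ∧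
    ∃ d : ℕ, ringKrullDim R = d ∧
      Nonempty (extGroup R d (R ⧸ IsLocalRing.maximalIdeal R) ω ≃ₗ[R]
        (R ⧸ IsLocalRing.maximalIdeal R))

/-- `T` is an Auslander transpose of `M`: the cokernel of the `R`-dual of a minimal
free presentation of `M`. -/
def IsAuslanderTranspose (R : Type) [CommRing R] [IsLocalRing R] (M T : Type)
    [AddCommGroup M] [Module R M] [AddCommGroup T] [Module R T] : Prop :=
  ∃ (m n : ℕ) (f : (Fin n → R) →ₗ[R] (Fin m → R)),
    LinearMap.range f ≤ (IsLocalRing.maximalIdeal R) • (⊤ : Submodule R (Fin m → R)) ∧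
    LinearMap.ker f ≤ (IsLocalRing.maximalIdeal R) • (⊤ : Submodule R (Fin n → R)) ∧
    Nonempty (((Fin m → R) ⧸ LinearMap.range f) ≃ₗ[R] M) ∧
    Nonempty ((Module.Dual R (Fin n → R) ⧸ LinearMap.range f.dualMap) ≃ₗ[R] T)

end

section

universe w v u

variable {C : Type u} [Category.{v} C] [Abelian C] [HasExt.{w} C] {X Y : C}

open CochainComplex HomComplex Abelian in
/-- In degree zero, a cocycle on a projective resolution vanishes in `Ext` only if it is zero. -/
lemma CategoryTheory.ProjectiveResolution.eq_zero_of_extMk_zero_eq_zero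
    (P : ProjectiveResolution X) (f : P.complex.X 0 ⟶ Y) (hf : P.complex.d 1 0 ≫ f = 0)
    (h : P.extMk f 1 rfl hf = 0) : f = 0 := by
  rw [← P.extEquivCohomologyClass.apply_eq_iff_eq,
    P.extEquivCohomologyClass_extMk, P.extEquivCohomologyClass_zero,
    CohomologyClass.mk_eq_zero_iff,
    Cocycle.toSingleMk_mem_coboundaries_iff _ _ _ _ _ 1 (by lia)] at h
  obtain ⟨g, hg⟩ := h
  rw [(CochainComplex.isZero_of_isStrictlyLE P.cochainComplex 0 1 (by lia)).eq_of_src g 0,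
    Limits.comp_zero] at hg
  rw [← cancel_epi (P.cochainComplexXIso (-(0 : ℕ)) 0 rfl).hom, ← hg, Limits.comp_zero]

end

section

variable {R : Type} [CommRing R] {X Y : ModuleCat.{0} R}

/-- The class map from cocycles on a projective resolution to `Ext`. -/
noncomputable def CategoryTheory.ProjectiveResolution.extMkLinearMap
    (P : ProjectiveResolution X) (n : ℕ) :
    LinearMap.ker (Linear.leftComp R Y (P.complex.d (n + 1) n)) →ₗ[R] Abelian.Ext X Y n where
  toFun f := P.extMk f.1 (n + 1) rfl (LinearMap.mem_ker.1 f.2)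
  map_add' f g :=
    (P.add_extMk f.1 g.1 (n + 1) rfl (LinearMap.mem_ker.1 f.2) (LinearMap.mem_ker.1 g.2)).symm
  map_smul' r f := by
    have h := P.extMk_comp_mk₀ f.1 (n + 1) rfl (LinearMap.mem_ker.1 f.2) (r • 𝟙 Y)
    rw [RingHom.id_apply, Abelian.Ext.smul_eq_comp_mk₀, h]
    simp

lemma CategoryTheory.ProjectiveResolution.extMkLinearMap_surjective
    (P : ProjectiveResolution X) (n : ℕ) :
    Function.Surjective (P.extMkLinearMap (Y := Y) n) := fun α ↦
  have ⟨f, hf, h⟩ := P.extMk_surjective α (n + 1) rfl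
  ⟨⟨f, hf⟩, h⟩

/-- The derived functor `Ext` agrees with `Ext` computed in the derived category. -/
lemma nonempty_extGroup_linearEquiv (R : Type) [CommRing R] (n : ℕ) (M N : Type)
    [AddCommGroup M] [Module R M] [AddCommGroup N] [Module R N] :
    Nonempty (extGroup R n M N ≃ₗ[R] Abelian.Ext (ModuleCat.of R M) (ModuleCat.of R N) n) := by
  let P := projectiveResolution (ModuleCat.of R M)
  let Y := ModuleCat.of R N
  let K := P.complex.linearYonedaObj R Y
  obtain ⟨i, hi⟩ : ∃ i, i = (ComplexShape.up ℕ).prev n := ⟨_, rfl⟩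
  let S := K.sc' i n (n + 1)
  let e₁ : extGroup R n M N ≃ₗ[R] K.homology n := (P.isoExt n Y).toLinearEquiv
  let e₂ : K.homology n ≃ₗ[R] S.homology :=
    (ShortComplex.homologyMapIso (K.isoSc' i n (n + 1) hi.symm (by simp))).toLinearEquiv
  let e₃ : S.homology ≃ₗ[R] (LinearMap.ker S.g.hom ⧸ LinearMap.range S.moduleCatToCycles) :=
    S.moduleCatHomologyIso.toLinearEquiv
  let φ : LinearMap.ker S.g.hom →ₗ[R] Abelian.Ext (ModuleCat.of R M) Y n :=
    P.extMkLinearMap (Y := Y) n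
  have hφ : LinearMap.ker φ = LinearMap.range S.moduleCatToCycles := by
    ext ⟨f, hf⟩
    rw [LinearMap.mem_ker, LinearMap.mem_range]
    cases n with
    | zero =>
      obtain rfl : i = 0 := by simpa using hi
      constructor
      · intro h
        refine ⟨0, Subtype.ext ?_⟩
        rw [map_zero]
        exact (P.eq_zero_of_extMk_zero_eq_zero f (LinearMap.mem_ker.1 hf) h).symm
      · rintro ⟨g, hg⟩
        have h0 : S.moduleCatToCycles g = 0 := by
          refine Subtype.ext ?_
          exact (congrArg (· ≫ g) (P.complex.shape 0 0 (by simp))).trans Limits.zero_comp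
        rw [← hg, h0, map_zero]
    | succ p =>
      obtain rfl : i = p := by simpa using hi
      refine (P.extMk_eq_zero_iff f (i + 1 + 1) rfl (LinearMap.mem_ker.1 hf) i rfl).trans ?_
      exact ⟨fun ⟨g, hg⟩ ↦ ⟨g, Subtype.ext hg⟩, fun ⟨g, hg⟩ ↦ ⟨g, congrArg Subtype.val hg⟩⟩
  let e₄ := (Submodule.quotEquivOfEq _ _ hφ.symm).trans
    (φ.quotKerEquivOfSurjective (P.extMkLinearMap_surjective n))
  exact ⟨e₁.trans (e₂.trans (e₃.trans e₄))⟩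
end

open RingTheory.Sequence Abelian Pointwise

section

variable {R : Type} [CommRing R]

lemma hasInjectiveDimensionLE_of_hasInjDimLE (n : ℕ) :
    ∀ (M : Type) [AddCommGroup M] [Module R M], hasInjDimLE R n M →
      HasInjectiveDimensionLE (ModuleCat.of R M) n := by
  induction n with
  | zero =>
    intro M _ _ (h : Module.Injective R M)
    have : Injective (ModuleCat.of R M) := Module.injective_object_of_injective_module R M
    exact inferInstanceAs (HasInjectiveDimensionLT (ModuleCat.of R M) 1)
  | succ n ih =>
    intro M _ _ ⟨I, _, _, f, hI, hf, h⟩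
    have hex : Function.Exact f (LinearMap.range f).mkQ := f.exact_map_mkQ_range
    have hS : (ModuleCat.shortComplexOfCompEqZero f (LinearMap.range f).mkQ
        hex.linearMap_comp_eq_zero).ShortExact :=
      { exact := ModuleCat.shortComplex_exact _ hex
        mono_f := (ModuleCat.mono_iff_injective _).2 hf
        epi_g := (ModuleCat.epi_iff_surjective _).2 (Submodule.mkQ_surjective _) }
    have : Injective (ModuleCat.of R I) := Module.injective_object_of_injective_module R I
    have h2 : HasInjectiveDimensionLT (ModuleCat.of R I) (n + 1 + 1) :=
      hasInjectiveDimensionLT_of_ge _ 1 _ (by lia)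
    exact hS.hasInjectiveDimensionLT_X₁ (n + 1) (ih _ h) h2

lemma CategoryTheory.Abelian.Ext.smul_eq_zero_of_forall_smul_eq_zero {N M : ModuleCat.{0} R} {x : R}
    (hx : ∀ n : N, x • n = 0) {i : ℕ} (α : Ext N M i) : x • α = 0 := by
  have h : x • 𝟙 N = 0 := by
    ext n
    exact hx n
  rw [← Ext.mk₀_id_comp α, ← Ext.smul_comp, ← Ext.mk₀_smul, h]
  simp

/-- The long exact `Ext` sequence of multiplication by a regular element. -/
lemma IsSMulRegular.exists_ext_exact {M : ModuleCat.{0} R} {x : R} (hx : IsSMulRegular M x) :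
    ∃ δ : Ext (ModuleCat.of R (QuotSMulTop x M)) M 1, ∀ N : ModuleCat.{0} R,
      (∀ i (α : Ext N M (i + 1)), x • α = 0 →
        ∃ β : Ext N (ModuleCat.of R (QuotSMulTop x M)) i, β.comp δ rfl = α) ∧
      (∀ i (β : Ext N (ModuleCat.of R (QuotSMulTop x M)) i), β.comp δ rfl = 0 →
        ∃ α : Ext N M i,
          α.comp (Ext.mk₀ (ModuleCat.ofHom (x • (⊤ : Submodule R M)).mkQ)) (add_zero i) = β) := by
  have hS := hx.smulShortComplex_shortExact (M := M)
  refine ⟨hS.extClass, fun N ↦ ⟨fun i α hα ↦ ?_, fun i β hβ ↦ ?_⟩⟩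
  · refine Ext.covariant_sequence_exact₁ _ hS α ?_ rfl
    rw [Ext.smul_eq_comp_mk₀] at hα
    exact hα
  · exact Ext.covariant_sequence_exact₃ _ hS β rfl hβ

lemma subsingleton_ext_of_isWeaklyRegular {N : ModuleCat.{0} R} (rs : List R)
    (hN : ∀ r ∈ rs, ∀ n : N, r • n = 0) :
    ∀ (M : ModuleCat.{0} R), IsWeaklyRegular M rs → ∀ i < rs.length, Subsingleton (Ext N M i) := by
  induction rs with
  | nil => simp
  | cons x rs ih =>
    intro M hM i hi
    rw [isWeaklyRegular_cons_iff] at hM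
    refine subsingleton_of_forall_eq 0 fun α ↦ ?_
    cases i with
    | zero =>
      obtain ⟨f, rfl⟩ := Ext.homEquiv₀.symm.surjective α
      have hf : f = 0 := by
        ext n
        refine hM.1 ?_
        have h : f.hom (x • n) = f.hom 0 := congrArg f.hom (hN x (by simp) n)
        rw [map_smul, map_zero] at h
        exact h.trans (smul_zero x).symm
      rw [Ext.homEquiv₀_symm_apply, hf, Ext.mk₀_zero]
    | succ i =>
      obtain ⟨δ, hδ⟩ := hM.1.exists_ext_exact
      obtain ⟨β, rfl⟩ := (hδ N).1 i α (Ext.smul_eq_zero_of_forall_smul_eq_zero (hN x (by simp)) α)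
      have := ih (fun r hr ↦ hN r (by simp [hr])) (ModuleCat.of R (QuotSMulTop x M)) hM.2 i
        (by simpa using hi)
      rw [Subsingleton.elim β 0, Ext.zero_comp]

/-- For a weakly `M`-regular sequence `rs`, the functors `Hom(-, M / rs M)` and `Ext(-, M)` in
degree the length of `rs` agree on modules killed by `rs`. -/
lemma exists_ext_forall_bijective_comp (rs : List R) : ∀ (M : ModuleCat.{0} R),
    IsWeaklyRegular M rs →
    ∃ θ : Ext (ModuleCat.of R (M ⧸ (Ideal.ofList rs • (⊤ : Submodule R M)))) M rs.length,
      ∀ N : ModuleCat.{0} R, (∀ r ∈ rs, ∀ n : N, r • n = 0) →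
        Function.Bijective
          (fun f : N ⟶ ModuleCat.of R (M ⧸ (Ideal.ofList rs • (⊤ : Submodule R M))) ↦
            (Ext.mk₀ f).comp θ (zero_add rs.length)) := by
  induction rs with
  | nil =>
    intro M _
    let e : (M ⧸ (Ideal.ofList ([] : List R) • (⊤ : Submodule R M))) ≃ₗ[R] M :=
      Submodule.quotEquivOfEqBot _ (by simp)
    refine ⟨Ext.mk₀ e.toModuleIso.hom, fun N _ ↦ ?_⟩
    have h := Ext.homEquiv₀.symm.bijective.comp
      (Iso.homCongr (Iso.refl N) e.toModuleIso).bijective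
    have hf (f : N ⟶ ModuleCat.of R (M ⧸ (Ideal.ofList ([] : List R) • (⊤ : Submodule R M)))) :
        (Ext.mk₀ f).comp (Ext.mk₀ e.toModuleIso.hom) (zero_add 0) =
          Ext.homEquiv₀.symm (Iso.homCongr (Iso.refl N) e.toModuleIso f) := by
      rw [Ext.homEquiv₀_symm_apply, Ext.mk₀_comp_mk₀, Iso.homCongr_apply]
      simp
    exact (funext hf).symm ▸ h
  | cons x rs ih =>
    intro M hM
    rw [isWeaklyRegular_cons_iff] at hM
    obtain ⟨θ, hθ⟩ := ih (ModuleCat.of R (QuotSMulTop x M)) hM.2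
    let e := Submodule.quotOfListConsSMulTopEquivQuotSMulTopInner M x rs
    obtain ⟨δ, hδ⟩ := hM.1.exists_ext_exact
    refine ⟨(Ext.mk₀ e.toModuleIso.hom).comp (θ.comp δ (rfl : rs.length + 1 = (x :: rs).length))
      (zero_add _), fun N hN ↦ ?_⟩
    have hN' : ∀ r ∈ rs, ∀ n : N, r • n = 0 := fun r hr ↦ hN r (by simp [hr])
    have hx {i : ℕ} (α : Ext N M i) : x • α = 0 :=
      Ext.smul_eq_zero_of_forall_smul_eq_zero (hN x (by simp)) α
    have hc (f : N ⟶ ModuleCat.of R (M ⧸ (Ideal.ofList (x :: rs) • (⊤ : Submodule R M)))) :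
        (Ext.mk₀ f).comp ((Ext.mk₀ e.toModuleIso.hom).comp
          (θ.comp δ (rfl : rs.length + 1 = (x :: rs).length)) (zero_add _)) (zero_add _) =
        ((Ext.mk₀ (f ≫ e.toModuleIso.hom)).comp θ (zero_add _)).comp δ rfl := by
      rw [Ext.mk₀_comp_mk₀_assoc, Ext.comp_assoc _ _ _ _ _ (by lia)]
    refine ⟨fun f g hfg ↦ ?_, fun α ↦ ?_⟩
    · simp only [hc] at hfg
      rw [← sub_eq_zero, sub_eq_add_neg, ← Ext.neg_comp, ← Ext.add_comp, ← sub_eq_add_neg] at hfg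
      obtain ⟨β, hβ⟩ := (hδ N).2 _ _ hfg
      have := subsingleton_ext_of_isWeaklyRegular (x :: rs) hN M
        ((isWeaklyRegular_cons_iff _ _ _).2 hM) rs.length (by simp)
      rw [Subsingleton.elim β 0, Ext.zero_comp, eq_comm, sub_eq_zero] at hβ
      exact (cancel_mono _).1 ((hθ N hN').1 hβ)
    · obtain ⟨β, rfl⟩ := (hδ N).1 _ α (hx α)
      obtain ⟨f, rfl⟩ := (hθ N hN').2 β
      exact ⟨f ≫ e.toModuleIso.inv, (hc _).trans
        (by rw [Category.assoc, Iso.inv_hom_id, Category.comp_id])⟩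

/-- If `Ext(X, M)` vanishes in degrees `1, …, rs.length`, every map `X → M / rs M` lifts to `M`. -/
lemma exists_lift_of_subsingleton_ext {X : ModuleCat.{0} R} (rs : List R) :
    ∀ (M : ModuleCat.{0} R), IsWeaklyRegular M rs →
    (∀ i, 1 ≤ i → i ≤ rs.length → Subsingleton (Ext X M i)) →
    ∀ f : X →ₗ[R] (M ⧸ (Ideal.ofList rs • (⊤ : Submodule R M))),
      ∃ g : X →ₗ[R] M, (Submodule.mkQ _).comp g = f := by
  induction rs with
  | nil =>
    intro M _ _ f
    let e : (M ⧸ (Ideal.ofList ([] : List R) • (⊤ : Submodule R M))) ≃ₗ[R] M :=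
      Submodule.quotEquivOfEqBot _ (by simp)
    refine ⟨e.toLinearMap.comp f, ?_⟩
    ext x
    obtain ⟨m, hm⟩ := Submodule.Quotient.mk_surjective _ (f x)
    simp [← hm, e]
  | cons x rs ih =>
    intro M hM hX f
    rw [isWeaklyRegular_cons_iff] at hM
    obtain ⟨δ, hδ⟩ := hM.1.exists_ext_exact
    let e := Submodule.quotOfListConsSMulTopEquivQuotSMulTopInner M x rs
    have hX' : ∀ i, 1 ≤ i → i ≤ rs.length →
        Subsingleton (Ext X (ModuleCat.of R (QuotSMulTop x M)) i) := fun i h1 h2 ↦ by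
      refine subsingleton_of_forall_eq 0 fun α ↦ ?_
      have := hX (i + 1) (by lia) (by simpa using h2)
      have := hX i h1 (by simp; lia)
      obtain ⟨β, rfl⟩ := (hδ X).2 _ α (Subsingleton.elim _ _)
      rw [Subsingleton.elim β 0, Ext.zero_comp]
    obtain ⟨g, hg⟩ := ih (ModuleCat.of R (QuotSMulTop x M)) hM.2 hX' (e.toLinearMap.comp f)
    have := hX 1 le_rfl (by simp)
    obtain ⟨α, hα⟩ := (hδ X).2 _ (Ext.mk₀ (ModuleCat.ofHom g)) (Subsingleton.elim _ _)
    obtain ⟨a, rfl⟩ := Ext.homEquiv₀.symm.surjective α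
    rw [Ext.homEquiv₀_symm_apply, Ext.mk₀_comp_mk₀] at hα
    have ha := Ext.homEquiv₀.symm.injective hα
    refine ⟨a.hom, ?_⟩
    ext y
    refine e.injective ?_
    have h1 := LinearMap.congr_fun hg y
    have h2 := congrArg (fun t ↦ t.hom y) ha
    refine Eq.trans ?_ h1
    exact congrArg (Submodule.mkQ (Ideal.ofList rs • (⊤ : Submodule R (QuotSMulTop x M)))) h2

end

section

variable {R : Type} [CommRing R]

section

variable {A B : Type} [AddCommGroup A] [Module R A] [AddCommGroup B] [Module R B]
  {f : A →ₗ[R] B} (M : ModuleCat.{0} R) (i : ℕ)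

lemma exists_comp_eq_of_subsingleton_ext (hf : Function.Injective f)
    (h : Subsingleton (Ext (ModuleCat.of R (B ⧸ LinearMap.range f)) M (i + 1)))
    (α : Ext (ModuleCat.of R A) M i) :
    ∃ β : Ext (ModuleCat.of R B) M i, (Ext.mk₀ (ModuleCat.ofHom f)).comp β (zero_add i) = α := by
  have hex : Function.Exact f (LinearMap.range f).mkQ := f.exact_map_mkQ_range
  have hS : (ModuleCat.shortComplexOfCompEqZero f (LinearMap.range f).mkQ
      hex.linearMap_comp_eq_zero).ShortExact :=
    { exact := ModuleCat.shortComplex_exact _ hex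
      mono_f := (ModuleCat.mono_iff_injective _).2 hf
      epi_g := (ModuleCat.epi_iff_surjective _).2 (Submodule.mkQ_surjective _) }
  exact Ext.contravariant_sequence_exact₁ hS M α (add_comm 1 i)
    (Subsingleton.elim (α := Ext (ModuleCat.of R (B ⧸ LinearMap.range f)) M (i + 1)) _ _)

lemma subsingleton_ext_of_subsingleton_of_subsingleton_quotient (hf : Function.Injective f)
    (h₁ : Subsingleton (Ext (ModuleCat.of R A) M i))
    (h₂ : Subsingleton (Ext (ModuleCat.of R (B ⧸ LinearMap.range f)) M i)) :
    Subsingleton (Ext (ModuleCat.of R B) M i) := by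
  have hex : Function.Exact f (LinearMap.range f).mkQ := f.exact_map_mkQ_range
  have hS : (ModuleCat.shortComplexOfCompEqZero f (LinearMap.range f).mkQ
      hex.linearMap_comp_eq_zero).ShortExact :=
    { exact := ModuleCat.shortComplex_exact _ hex
      mono_f := (ModuleCat.mono_iff_injective _).2 hf
      epi_g := (ModuleCat.epi_iff_surjective _).2 (Submodule.mkQ_surjective _) }
  refine subsingleton_of_forall_eq 0 fun α ↦ ?_
  obtain ⟨β, hβ⟩ := Ext.contravariant_sequence_exact₂ hS M α
    (Subsingleton.elim (α := Ext (ModuleCat.of R A) M _) _ _)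
  rw [← hβ, Subsingleton.elim (α := Ext (ModuleCat.of R (B ⧸ LinearMap.range f)) M i) β 0,
    Ext.comp_zero]

end

lemma subsingleton_ext_congr {A B : Type} [AddCommGroup A] [Module R A] [AddCommGroup B]
    [Module R B] (e : A ≃ₗ[R] B) (M : ModuleCat.{0} R) (i : ℕ)
    (h : Subsingleton (Ext (ModuleCat.of R A) M i)) :
    Subsingleton (Ext (ModuleCat.of R B) M i) := by
  refine subsingleton_of_forall_eq 0 fun α ↦ ?_
  have h1 : (Ext.mk₀ e.toModuleIso.inv).comp ((Ext.mk₀ e.toModuleIso.hom).comp α (zero_add i))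
      (zero_add i) = α := by
    rw [Ext.mk₀_comp_mk₀_assoc, Iso.inv_hom_id, Ext.mk₀_id_comp]
  rw [← h1, Subsingleton.elim ((Ext.mk₀ e.toModuleIso.hom).comp α (zero_add i)) 0, Ext.comp_zero]

/-- The comparison of `Hom(N, M / rs M)` with `Ext(N, M)`, linearly. -/
lemma nonempty_linearEquiv_ext {rs : List R} {M N : Type} [AddCommGroup M] [Module R M]
    [AddCommGroup N] [Module R N] (hM : IsWeaklyRegular M rs)
    (hN : ∀ r ∈ rs, ∀ n : N, r • n = 0) :
    Nonempty ((N →ₗ[R] (M ⧸ (Ideal.ofList rs • (⊤ : Submodule R M)))) ≃ₗ[R]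
      Ext (ModuleCat.of R N) (ModuleCat.of R M) rs.length) := by
  obtain ⟨θ, hθ⟩ := exists_ext_forall_bijective_comp rs (ModuleCat.of R M) hM
  let φ : (N →ₗ[R] (M ⧸ (Ideal.ofList rs • (⊤ : Submodule R M)))) →ₗ[R]
      Ext (ModuleCat.of R N) (ModuleCat.of R M) rs.length :=
    { toFun f := (Ext.mk₀ (ModuleCat.ofHom f)).comp θ (zero_add _)
      map_add' f g := by rw [ModuleCat.ofHom_add, Ext.mk₀_add, Ext.add_comp]
      map_smul' r f := by
        rw [RingHom.id_apply, ← Ext.smul_comp, ← Ext.mk₀_smul]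
        rfl }
  exact ⟨LinearEquiv.ofBijective φ
    ((hθ (ModuleCat.of R N) hN).comp (ModuleCat.homEquiv (M := ModuleCat.of R N)
      (N := ModuleCat.of R (M ⧸ (Ideal.ofList rs • (⊤ : Submodule R M))))).symm.bijective)⟩

variable [IsLocalRing R]

lemma nonempty_linearEquiv_of_isSimpleModule (S : Type) [AddCommGroup S] [Module R S]
    [IsSimpleModule R S] : Nonempty ((R ⧸ maximalIdeal R) ≃ₗ[R] S) := by
  obtain ⟨I, hI, ⟨e⟩⟩ := (isSimpleModule_iff_quot_maximal (R := R) (M := S)).1 inferInstance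
  obtain rfl := IsLocalRing.eq_maximalIdeal hI
  exact ⟨e.symm⟩

lemma IsFiniteLength.exists_injective_residue {N : Type} [AddCommGroup N] [Module R N]
    [Nontrivial N] (hN : IsFiniteLength R N) :
    ∃ f : (R ⧸ maximalIdeal R) →ₗ[R] N, Function.Injective f := by
  rw [isFiniteLength_iff_isNoetherian_isArtinian] at hN
  obtain ⟨_, _⟩ := hN
  obtain ⟨S, hS⟩ := IsAtomic.exists_atom (Submodule R N)
  have : IsSimpleModule R S := isSimpleModule_iff_isAtom.2 hS
  obtain ⟨e⟩ := nonempty_linearEquiv_of_isSimpleModule (R := R) S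
  exact ⟨S.subtype.comp e.toLinearMap, S.subtype_injective.comp e.injective⟩

lemma IsFiniteLength.exists_mem_ne_zero {N : Type} [AddCommGroup N] [Module R N]
    (hN : IsFiniteLength R N) {P : Submodule R N} (hP : P ≠ ⊥) :
    ∃ y ∈ P, y ≠ 0 ∧ ∀ x ∈ maximalIdeal R, x • y = 0 := by
  have : Nontrivial P := (Submodule.nontrivial_iff_ne_bot).2 hP
  obtain ⟨f, hf⟩ := (hN.of_injective P.subtype_injective).exists_injective_residue
  refine ⟨f (Submodule.Quotient.mk 1), (f _).2, fun h ↦ ?_, fun x hx ↦ ?_⟩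
  · have h1 := hf ((Subtype.ext h : f (Submodule.Quotient.mk 1) = 0).trans (map_zero f).symm)
    rw [Submodule.Quotient.mk_eq_zero] at h1
    exact (maximalIdeal.isMaximal R).ne_top ((Ideal.eq_top_iff_one _).2 h1)
  · rw [← Submodule.coe_smul, ← map_smul, ← Submodule.Quotient.mk_smul,
      (Submodule.Quotient.mk_eq_zero _).2 (by simpa using hx), map_zero, Submodule.coe_zero]

lemma IsFiniteLength.subsingleton_ext {M : ModuleCat.{0} R} {i : ℕ}
    (h : Subsingleton (Ext (ModuleCat.of R (R ⧸ maximalIdeal R)) M i)) {N : Type} [AddCommGroup N]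
    [Module R N] (hN : IsFiniteLength R N) : Subsingleton (Ext (ModuleCat.of R N) M i) := by
  induction hN with
  | @of_subsingleton N _ _ hN =>
    refine subsingleton_of_forall_eq 0 fun α ↦ ?_
    have h0 : 𝟙 (ModuleCat.of R N) = 0 := by
      ext n
      exact Subsingleton.elim (α := N) _ _
    rw [← Ext.mk₀_id_comp α, h0]
    simp
  | @of_simple_quotient N _ _ P _ hP ih =>
    obtain ⟨e⟩ := nonempty_linearEquiv_of_isSimpleModule (R := R) (N ⧸ P)
    refine subsingleton_ext_of_subsingleton_of_subsingleton_quotient M i P.subtype_injective ih ?_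
    exact subsingleton_ext_congr (e.trans (Submodule.quotEquivOfEq _ _ P.range_subtype.symm)) M i h

variable [IsNoetherianRing R]

lemma subsingleton_ext_of_length_lt {rs : List R} (hrs : IsWeaklyRegular R rs)
    (hm : ∀ r ∈ rs, r ∈ maximalIdeal R)
    (hfl : IsFiniteLength R (R ⧸ (Ideal.ofList rs • (⊤ : Submodule R R))))
    (M : ModuleCat.{0} R) (n : ℕ) [HasInjectiveDimensionLT M n] {N : Type} [AddCommGroup N]
    [Module R N] (hN : IsFiniteLength R N) {i : ℕ} (hi : rs.length < i) :
    Subsingleton (Ext (ModuleCat.of R N) M i) := by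
  suffices H : ∀ j, ∀ i, rs.length < i → n ≤ i + j → ∀ (N : Type) [AddCommGroup N]
      [Module R N], IsFiniteLength R N → Subsingleton (Ext (ModuleCat.of R N) M i) from
    H n i hi (by lia) N hN
  intro j
  induction j with
  | zero =>
    intro i _ hi N _ _ _
    exact HasInjectiveDimensionLT.subsingleton M n i (by lia) _
  | succ j ih =>
    intro i hi hij N _ _ hN
    refine hN.subsingleton_ext ?_
    have : Nontrivial (R ⧸ (Ideal.ofList rs • (⊤ : Submodule R R))) := by
      rw [Submodule.Quotient.nontrivial_iff]
      intro h
      have h1 : (1 : R) ∈ Ideal.ofList rs • (⊤ : Submodule R R) := by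
        rw [h]; exact Submodule.mem_top
      have h2 : Ideal.ofList rs • (⊤ : Submodule R R) ≤ maximalIdeal R := by
        rw [smul_eq_mul, Ideal.mul_top]
        exact Ideal.span_le.2 hm
      exact (maximalIdeal.isMaximal R).ne_top ((Ideal.eq_top_iff_one _).2 (h2 h1))
    obtain ⟨f, hf⟩ := hfl.exists_injective_residue
    have hpd : HasProjectiveDimensionLE
        (ModuleCat.of R (R ⧸ (Ideal.ofList rs • (⊤ : Submodule R R)))) rs.length := by
      rw [← projectiveDimension_le_iff]
      have := ModuleCat.projectiveDimension_quotient_eq_add_length_of_isWeaklyRegular (ModuleCat.of R R) rs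
        hrs hm
      refine this.le.trans ?_
      have hp : projectiveDimension (ModuleCat.of R R) ≤ (0 : ℕ) := by
        rw [projectiveDimension_le_iff]
        have : Projective (ModuleCat.of R R) := inferInstance
        exact inferInstance
      refine (add_le_add_left hp _).trans ?_
      simp
    have h0 : Subsingleton
        (Ext (ModuleCat.of R (R ⧸ (Ideal.ofList rs • (⊤ : Submodule R R)))) M i) :=
      HasProjectiveDimensionLT.subsingleton _ (rs.length + 1) i hi M
    refine subsingleton_of_forall_eq 0 fun α ↦ ?_
    obtain ⟨β, rfl⟩ := exists_comp_eq_of_subsingleton_ext M i hf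
      (ih (i + 1) (by lia) (by lia) _ (hfl.of_surjective (Submodule.mkQ_surjective _))) α
    rw [Subsingleton.elim β 0, Ext.comp_zero]

/-- Injectivity of `M / rs M` with respect to finite length modules killed by `rs`. -/
lemma exists_extension_of_isFiniteLength {rs : List R} (hrs : IsWeaklyRegular R rs)
    (hm : ∀ r ∈ rs, r ∈ maximalIdeal R)
    (hfl : IsFiniteLength R (R ⧸ (Ideal.ofList rs • (⊤ : Submodule R R))))
    {M : Type} [AddCommGroup M] [Module R M] (hM : IsWeaklyRegular M rs)
    (n : ℕ) [HasInjectiveDimensionLT (ModuleCat.of R M) n] {A B : Type} [AddCommGroup A]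
    [Module R A] [AddCommGroup B] [Module R B] (hB : IsFiniteLength R B)
    (hB0 : ∀ r ∈ rs, ∀ b : B, r • b = 0) {f : A →ₗ[R] B} (hf : Function.Injective f)
    (g : A →ₗ[R] (M ⧸ (Ideal.ofList rs • (⊤ : Submodule R M)))) :
    ∃ h : B →ₗ[R] (M ⧸ (Ideal.ofList rs • (⊤ : Submodule R M))), h.comp f = g := by
  obtain ⟨θ, hθ⟩ := exists_ext_forall_bijective_comp rs (ModuleCat.of R M) hM
  obtain ⟨β, hβ⟩ := exists_comp_eq_of_subsingleton_ext (ModuleCat.of R M) rs.length hf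
    (subsingleton_ext_of_length_lt hrs hm hfl (ModuleCat.of R M) n
      (hB.of_surjective (Submodule.mkQ_surjective _)) (Nat.lt_succ_self _))
    ((Ext.mk₀ (ModuleCat.ofHom g)).comp θ (zero_add _))
  obtain ⟨h, rfl⟩ := (hθ (ModuleCat.of R B) hB0).2 β
  refine ⟨h.hom, ?_⟩
  have hA0 : ∀ r ∈ rs, ∀ a : A, r • a = 0 := fun r hr a ↦ hf (by simp [hB0 r hr])
  have h1 : ModuleCat.ofHom f ≫ h = ModuleCat.ofHom g := by
    refine (hθ (ModuleCat.of R A) hA0).1 ?_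
    exact (Ext.mk₀_comp_mk₀_assoc _ _ _).symm.trans hβ
  exact congrArg ModuleCat.Hom.hom h1

end

section

/-- Maps into `E` extend along injections of finite length modules killed by `J`. -/
def HasExtensionProperty {R : Type} [CommRing R] (J : Ideal R) (E : Type) [AddCommGroup E]
    [Module R E] : Prop :=
  ∀ (A B : Type) [AddCommGroup A] [Module R A] [AddCommGroup B] [Module R B], IsFiniteLength R B →
    (∀ r ∈ J, ∀ b : B, r • b = 0) → ∀ f : A →ₗ[R] B, Function.Injective f →
      ∀ g : A →ₗ[R] E, ∃ h : B →ₗ[R] E, h.comp f = g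

variable {R : Type} [CommRing R] {J : Ideal R} {E : Type} [AddCommGroup E] [Module R E]

lemma Module.length_le_add_of_exact {A B C : Type} [AddCommGroup A] [Module R A] [AddCommGroup B]
    [Module R B] [AddCommGroup C] [Module R C] (f : A →ₗ[R] B) (g : B →ₗ[R] C)
    (h : Function.Exact f g) : Module.length R B ≤ Module.length R A + Module.length R C := by
  have h1 : Function.Exact (LinearMap.range f).subtype g.rangeRestrict := by
    intro b
    rw [Submodule.coe_subtype, Subtype.range_coe, SetLike.mem_coe, LinearMap.mem_range,
      ← Set.mem_range, ← h b, Subtype.ext_iff]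
    rfl
  rw [Module.length_eq_add_of_exact _ _ (Submodule.subtype_injective _)
    g.surjective_rangeRestrict h1]
  exact add_le_add (Module.length_le_of_surjective _ f.surjective_rangeRestrict)
    (Module.length_le_of_injective _ (Submodule.subtype_injective _))

variable [IsLocalRing R]

lemma HasExtensionProperty.mem_of_forall_smul_eq_zero (hext : HasExtensionProperty J E)
    (hfl : IsFiniteLength R (R ⧸ J)) (htype : Nontrivial ((R ⧸ maximalIdeal R) →ₗ[R] E))
    {r : R} (hr : ∀ e : E, r • e = 0) : r ∈ J := by
  by_contra hrJ
  let P : Submodule R (R ⧸ J) :=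
    Submodule.map J.mkQ (Module.annihilator R E : Submodule R R)
  have hP : P ≠ ⊥ := by
    refine (Submodule.ne_bot_iff _).2 ⟨J.mkQ r, ?_, ?_⟩
    · exact Submodule.mem_map_of_mem (f := J.mkQ) (Module.mem_annihilator.2 hr)
    · simpa [Ideal.Quotient.eq_zero_iff_mem] using hrJ
  have : Nontrivial P := (Submodule.nontrivial_iff_ne_bot).2 hP
  obtain ⟨f, hf⟩ := (hfl.of_injective P.subtype_injective).exists_injective_residue
  obtain ⟨g, hg⟩ := exists_ne (0 : (R ⧸ maximalIdeal R) →ₗ[R] E)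
  obtain ⟨h, rfl⟩ := hext _ _ hfl
    (by
      intro s hs b
      obtain ⟨b, rfl⟩ := Ideal.Quotient.mk_surjective b
      exact Ideal.Quotient.eq_zero_iff_mem.2 (J.mul_mem_right b hs)) (P.subtype.comp f)
    (P.subtype_injective.comp hf) g
  refine hg (LinearMap.ext fun x ↦ ?_)
  obtain ⟨s, hs, hsx⟩ := (f x).2
  have h1 : J.mkQ s = s • J.mkQ 1 := by rw [← map_smul, smul_eq_mul, mul_one]
  rw [LinearMap.comp_apply, LinearMap.comp_apply, Submodule.subtype_apply, ← hsx, h1, map_smul,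
    Module.mem_annihilator.1 hs, LinearMap.zero_apply]

lemma length_linearMap_le
    (htype : Nonempty (((R ⧸ maximalIdeal R) →ₗ[R] E) ≃ₗ[R] (R ⧸ maximalIdeal R)))
    {N : Type} [AddCommGroup N] [Module R N] (hN : IsFiniteLength R N) :
    Module.length R (N →ₗ[R] E) ≤ Module.length R N := by
  induction hN with
  | of_subsingleton => simp
  | @of_simple_quotient N _ _ P _ hP ih =>
    obtain ⟨e⟩ := nonempty_linearEquiv_of_isSimpleModule (R := R) (N ⧸ P)
    obtain ⟨e'⟩ := htype
    have h1 : Module.length R ((N ⧸ P) →ₗ[R] E) = Module.length R (N ⧸ P) :=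
      ((LinearEquiv.congrLeft E R e.symm).trans e').length_eq.trans e.length_eq
    have hex : Function.Exact (LinearMap.lcomp R E P.mkQ) (LinearMap.lcomp R E P.subtype) := by
      intro f
      constructor
      · intro hf
        refine ⟨P.liftQ f fun x hx ↦ ?_, by ext; simp⟩
        exact LinearMap.congr_fun hf ⟨x, hx⟩
      · rintro ⟨g, rfl⟩
        refine LinearMap.ext fun x ↦ (congrArg g ?_).trans (map_zero g)
        exact (Submodule.Quotient.mk_eq_zero P).2 x.2
    refine (Module.length_le_add_of_exact _ _ hex).trans ?_
    rw [h1, Module.length_eq_add_of_exact P.subtype P.mkQ P.subtype_injective P.mkQ_surjective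
      (LinearMap.exact_subtype_mkQ P), add_comm]
    exact add_le_add_left ih _

lemma HasExtensionProperty.exists_eq_smul (hext : HasExtensionProperty J E)
    (hfl : IsFiniteLength R (R ⧸ J)) (hJ : ∀ r ∈ J, ∀ e : E, r • e = 0) (hE : IsFiniteLength R E)
    (htype : Nonempty (((R ⧸ maximalIdeal R) →ₗ[R] E) ≃ₗ[R] (R ⧸ maximalIdeal R)))
    (φ : E →ₗ[R] E) : ∃ r : R, ∀ e, φ e = r • e := by
  have hk : Nontrivial ((R ⧸ maximalIdeal R) →ₗ[R] E) :=
    htype.some.toEquiv.nontrivial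
  have hJ' : J ≤ LinearMap.ker (LinearMap.lsmul R E) :=
    fun r hr ↦ LinearMap.ext fun e ↦ hJ r hr e
  let i : (R ⧸ J) →ₗ[R] (E →ₗ[R] E) := Submodule.liftQ J (LinearMap.lsmul R E) hJ'
  have hi : Function.Injective i := by
    refine LinearMap.ker_eq_bot.1 (Submodule.ker_liftQ_eq_bot _ _ _ fun r hr ↦ ?_)
    exact hext.mem_of_forall_smul_eq_zero hfl hk (LinearMap.congr_fun hr)
  let c : E →ₗ[R] ((R ⧸ J) →ₗ[R] E) :=
    { toFun e := J.liftQ (LinearMap.toSpanSingleton R E e) fun r hr ↦ hJ r hr e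
      map_add' a b := by
        refine LinearMap.ext fun y ↦ ?_
        obtain ⟨y, rfl⟩ := J.mkQ_surjective y
        exact smul_add y a b
      map_smul' a b := by
        refine LinearMap.ext fun y ↦ ?_
        obtain ⟨y, rfl⟩ := J.mkQ_surjective y
        exact smul_comm y a b }
  have hc : Function.Injective c := fun a b hab ↦ by
    have h : (1 : R) • a = (1 : R) • b := LinearMap.congr_fun hab (J.mkQ 1)
    rwa [one_smul, one_smul] at h
  have hlen : Module.length R (E →ₗ[R] E) ≤ Module.length R (R ⧸ J) :=
    (length_linearMap_le htype hE).trans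
      ((Module.length_le_of_injective _ hc).trans (length_linearMap_le htype hfl))
  have hEnd : IsFiniteLength R (E →ₗ[R] E) := Module.length_ne_top_iff.1
    (hlen.trans_lt (Module.length_ne_top_iff.2 hfl).lt_top).ne
  obtain ⟨_, _⟩ := isFiniteLength_iff_isNoetherian_isArtinian.1 hEnd
  have htop : LinearMap.range i = ⊤ := by
    by_contra h
    refine (Submodule.length_lt h).not_ge (hlen.trans ?_)
    exact Module.length_le_of_injective i.rangeRestrict
      (LinearMap.injective_rangeRestrict_iff i |>.2 hi)
  obtain ⟨y, hy⟩ := LinearMap.range_eq_top.1 htop φ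
  obtain ⟨r, rfl⟩ := J.mkQ_surjective y
  exact ⟨r, fun e ↦ (LinearMap.congr_fun hy e).symm⟩

end

section

variable {R : Type} [CommRing R] [IsLocalRing R] [IsNoetherianRing R]

lemma forall_end_eq_smul_of_quotSMulTop {M : Type} [AddCommGroup M] [Module R M]
    [Module.Finite R M] {x : R} (hx : IsSMulRegular M x) (hxm : x ∈ maximalIdeal R)
    (h : ∀ φ : QuotSMulTop x M →ₗ[R] QuotSMulTop x M, ∃ r : R, ∀ e, φ e = r • e)
    (φ : M →ₗ[R] M) : ∃ r : R, ∀ e, φ e = r • e := by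
  have hdiv (φ : M →ₗ[R] M) : ∃ (r : R) (ψ : M →ₗ[R] M), φ = r • LinearMap.id + x • ψ := by
    obtain ⟨r, hr⟩ := h (Submodule.mapQ _ _ φ (by
      rintro _ ⟨m, -, rfl⟩
      refine ⟨φ m, trivial, ?_⟩
      simp))
    have h1 (m : M) : ∃ m' : M, φ m = r • m + x • m' := by
      have h2 := hr (Submodule.Quotient.mk m)
      rw [Submodule.mapQ_apply, ← Submodule.Quotient.mk_smul, Submodule.Quotient.eq] at h2
      obtain ⟨m', -, hm'⟩ := h2
      exact ⟨m', by
        rw [← sub_eq_iff_eq_add']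
        exact hm'.symm⟩
    choose ψ hψ using h1
    refine ⟨r, { toFun := ψ, map_add' := fun a b ↦ hx ?_, map_smul' := fun s a ↦ hx ?_ }, ?_⟩
    · have h2 := hψ (a + b)
      rw [map_add, hψ a, hψ b] at h2
      have h3 : r • (a + b) + x • (ψ a + ψ b) = r • (a + b) + x • ψ (a + b) := by
        rw [← h2]
        module
      exact (add_left_cancel h3).symm
    · have h2 := hψ (s • a)
      rw [map_smul, hψ a] at h2
      have h3 : r • s • a + x • s • ψ a = r • s • a + x • ψ (s • a) := by
        rw [← h2]
        module
      exact (add_left_cancel h3).symm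
    · ext m
      exact hψ m
  have htop : (⊤ : Submodule R (M →ₗ[R] M)) ≤ Submodule.span R {LinearMap.id} := by
    refine Submodule.le_of_le_smul_of_le_jacobson_bot (I := Ideal.span {x})
      (IsNoetherian.noetherian _) ?_ fun φ _ ↦ ?_
    · rw [IsLocalRing.jacobson_eq_maximalIdeal _ bot_ne_top]
      exact (Ideal.span_singleton_le_iff_mem _).2 hxm
    · obtain ⟨r, ψ, rfl⟩ := hdiv φ
      exact Submodule.add_mem_sup (Submodule.smul_mem _ _ (Submodule.mem_span_singleton_self _))
        (Submodule.smul_mem_smul (Ideal.mem_span_singleton_self x) trivial)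
  obtain ⟨r, rfl⟩ := Submodule.mem_span_singleton.1 (htop (Submodule.mem_top (x := φ)))
  exact ⟨r, fun e ↦ rfl⟩

lemma forall_end_eq_smul_of_isWeaklyRegular (rs : List R) (hm : ∀ r ∈ rs, r ∈ maximalIdeal R) :
    ∀ (M : Type) [AddCommGroup M] [Module R M] [Module.Finite R M], IsWeaklyRegular M rs →
    (∀ φ : (M ⧸ (Ideal.ofList rs • (⊤ : Submodule R M))) →ₗ[R]
      (M ⧸ (Ideal.ofList rs • (⊤ : Submodule R M))), ∃ r : R, ∀ e, φ e = r • e) →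
    ∀ φ : M →ₗ[R] M, ∃ r : R, ∀ e, φ e = r • e := by
  induction rs with
  | nil =>
    intro M _ _ _ _ h φ
    let e : (M ⧸ (Ideal.ofList ([] : List R) • (⊤ : Submodule R M))) ≃ₗ[R] M :=
      Submodule.quotEquivOfEqBot _ (by simp)
    obtain ⟨r, hr⟩ := h (e.symm.toLinearMap.comp (φ.comp e.toLinearMap))
    exact ⟨r, fun m ↦ e.symm.injective (by simpa using hr (e.symm m))⟩
  | cons x rs ih =>
    intro M _ _ _ hM h φ
    rw [isWeaklyRegular_cons_iff] at hM
    let e := Submodule.quotOfListConsSMulTopEquivQuotSMulTopInner M x rs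
    refine forall_end_eq_smul_of_quotSMulTop hM.1 (hm x (by simp))
      (ih (fun r hr ↦ hm r (by simp [hr])) (QuotSMulTop x M) hM.2 fun ψ ↦ ?_) φ
    obtain ⟨r, hr⟩ := h (e.symm.toLinearMap.comp (ψ.comp e.toLinearMap))
    exact ⟨r, fun m ↦ e.symm.injective (by simpa using hr (e.symm m))⟩

lemma annihilator_le_of_isWeaklyRegular (rs : List R) (hm : ∀ r ∈ rs, r ∈ maximalIdeal R) :
    ∀ (M : Type) [AddCommGroup M] [Module R M] (J : Ideal R), IsWeaklyRegular M rs →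
    J ≤ Module.annihilator R M →
    Module.annihilator R (M ⧸ (Ideal.ofList rs • (⊤ : Submodule R M))) ≤ J ⊔ Ideal.ofList rs →
    Module.annihilator R M ≤ J := by
  induction rs with
  | nil =>
    intro M _ _ J _ _ h
    let e : (M ⧸ (Ideal.ofList ([] : List R) • (⊤ : Submodule R M))) ≃ₗ[R] M :=
      Submodule.quotEquivOfEqBot _ (by simp)
    rw [e.annihilator_eq] at h
    simpa using h
  | cons x rs ih =>
    intro M _ _ J hM hJ h
    rw [isWeaklyRegular_cons_iff] at hM
    rw [(Submodule.quotOfListConsSMulTopEquivQuotSMulTopInner M x rs).annihilator_eq,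
      Ideal.ofList_cons, ← sup_assoc] at h
    have h1 : Module.annihilator R (QuotSMulTop x M) ≤ J ⊔ Ideal.span {x} := by
      refine ih (fun r hr ↦ hm r (by simp [hr])) _ _ hM.2 (sup_le ?_ ?_) h
      · exact hJ.trans (LinearMap.annihilator_le_of_surjective _ (Submodule.mkQ_surjective _))
      · rw [Ideal.span_singleton_le_iff_mem, Module.mem_annihilator]
        intro m
        obtain ⟨m, rfl⟩ := Submodule.mkQ_surjective _ m
        rw [← map_smul]
        exact (Submodule.Quotient.mk_eq_zero _).2 (Submodule.smul_mem_pointwise_smul _ _ _ trivial)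
    refine Submodule.le_of_le_smul_of_le_jacobson_bot (I := Ideal.span {x})
      (IsNoetherian.noetherian _) ?_ fun r hr ↦ ?_
    · rw [IsLocalRing.jacobson_eq_maximalIdeal _ bot_ne_top]
      exact (Ideal.span_singleton_le_iff_mem _).2 (hm x (by simp))
    · obtain ⟨j, hj, y, hy, rfl⟩ := Submodule.mem_sup.1
        (h1 (LinearMap.annihilator_le_of_surjective _ (Submodule.mkQ_surjective _) hr))
      obtain ⟨s, rfl⟩ := Ideal.mem_span_singleton'.1 hy
      refine Submodule.add_mem_sup hj ?_
      rw [mul_comm, ← smul_eq_mul x s]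
      refine Submodule.smul_mem_smul (Ideal.mem_span_singleton_self x) ?_
      refine Module.mem_annihilator.2 fun m ↦ hM.1 ?_
      have h2 := Module.mem_annihilator.1 hr m
      rw [add_smul, Module.mem_annihilator.1 (hJ hj), zero_add, mul_comm, mul_smul] at h2
      exact h2.trans (smul_zero x).symm

end

section

variable {S : Type} [CommRing S] [IsLocalRing S]

lemma HasExtensionProperty.exists_linearMap_apply_eq_one (hext : HasExtensionProperty (⊥ : Ideal S) S)
    (hS : IsFiniteLength S S) (W : Type) [AddCommGroup W] [Module S W]
    (hW : IsFiniteLength S W) (hfaith : ∀ s : S, (∀ w : W, s • w = 0) → s = 0) :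
    ∃ (π : W →ₗ[S] S) (e : W), π e = 1 := by
  obtain ⟨f, hf⟩ := hS.exists_injective_residue
  set σ := f (Submodule.Quotient.mk 1) with hσ
  have hσ0 : σ ≠ 0 := by
    intro h
    have : (Submodule.Quotient.mk 1 : S ⧸ maximalIdeal S) = 0 := hf (by rw [← hσ, h, map_zero])
    rw [Submodule.Quotient.mk_eq_zero] at this
    exact (Ideal.ne_top_iff_one _).1 (IsLocalRing.maximalIdeal.isMaximal S).ne_top this
  have key : ∀ y : S, y ≠ 0 → (∀ x ∈ maximalIdeal S, x • y = 0) → ∃ s, σ = s * y := by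
    intro y hy hmy
    let g : (S ⧸ maximalIdeal S) →ₗ[S] S := Submodule.liftQ _ (LinearMap.toSpanSingleton S S y)
      (fun x hx ↦ by simpa using hmy x hx)
    have hg : Function.Injective g := by
      rw [← LinearMap.ker_eq_bot]
      refine Submodule.ker_liftQ_eq_bot _ _ _ fun x hx ↦ ?_
      by_contra hxm
      have hu : IsUnit x := by simpa using hxm
      have : x * y = 0 := by simpa using hx
      exact hy ((hu.mul_right_eq_zero).1 this)
    obtain ⟨h, hh⟩ := hext _ _ hS (by simp) g hg f
    refine ⟨h 1, ?_⟩
    have h1 := LinearMap.congr_fun hh (Submodule.Quotient.mk 1)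
    have h2 : g (Submodule.Quotient.mk 1) = y := one_smul S y
    rw [LinearMap.comp_apply, h2] at h1
    rw [hσ, ← h1, mul_comm, ← smul_eq_mul, ← map_smul, smul_eq_mul, mul_one]
  obtain ⟨e, he⟩ : ∃ e : W, σ • e ≠ 0 := by
    by_contra! h
    exact hσ0 (hfaith σ h)
  let j : S →ₗ[S] W := LinearMap.toSpanSingleton S W e
  have hj : Function.Injective j := by
    rw [← LinearMap.ker_eq_bot]
    by_contra hker
    obtain ⟨y, hy, hy0, hmy⟩ := hS.exists_mem_ne_zero hker
    obtain ⟨s, hs⟩ := key y hy0 hmy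
    apply he
    have : y • e = 0 := by simpa [j] using hy
    rw [hs, mul_smul, this, smul_zero]
  obtain ⟨π, hπ⟩ := hext _ _ hW (by simp) j hj LinearMap.id
  exact ⟨π, e, by simpa [j] using LinearMap.congr_fun hπ 1⟩

end

section

variable {R : Type} [CommRing R] [IsNoetherianRing R] {M : Type} [AddCommGroup M] [Module R M]

lemma forall_smul_eq_smul_of_exists_apply_notMem [Module.Finite R M]
    (hend : ∀ φ : M →ₗ[R] M, ∃ r : R, ∀ x, φ x = r • x)
    (hass : ∀ p : Ideal R, IsAssociatedPrime p M → ∃ (π : M →ₗ[R] R) (e : M), π e ∉ p)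
    (φ : M →ₗ[R] R) (a b : M) : φ a • b = φ b • a := by
  by_contra hne
  set c := φ a • b - φ b • a with hc
  have hc0 : c ≠ 0 := sub_ne_zero.2 hne
  obtain ⟨P, hP, hle⟩ := exists_le_isAssociatedPrime_of_isNoetherianRing R c hc0
  obtain ⟨π, e, hu⟩ := hass P hP
  have H (x : M) : ∃ r : R, π e • x = r • e := by
    obtain ⟨r, hr⟩ := hend (π.smulRight x)
    exact ⟨r, by simpa using hr e⟩
  obtain ⟨ra, ha⟩ := H a
  obtain ⟨rb, hb⟩ := H b
  have : (π e * π e) • c = 0 := by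
    have h1 : (π e * π e) • c = φ (π e • a) • (π e • b) - φ (π e • b) • (π e • a) := by
      simp only [hc, map_smul, smul_eq_mul]
      module
    rw [h1, ha, hb]
    simp only [map_smul, smul_eq_mul]
    module
  have hmem : π e * π e ∈ P := hle (by
    rw [Submodule.mem_colon_singleton]
    simpa using this)
  rcases hP.isPrime.mem_or_mem hmem with h | h <;> exact hu h

end

section

variable {R : Type} [CommRing R] [IsLocalRing R] {N : Type} [AddCommGroup N] [Module R N]

lemma subsingleton_ext_of_lt_moduleDepth {n : ℕ} (h : (n : ℕ∞) < moduleDepth R N) :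
    Subsingleton (Ext (ModuleCat.of R (R ⧸ maximalIdeal R)) (ModuleCat.of R N) n) := by
  obtain ⟨e⟩ := nonempty_extGroup_linearEquiv R n (R ⧸ maximalIdeal R) N
  rw [← e.toEquiv.subsingleton_congr, ← not_nontrivial_iff_subsingleton]
  intro hn
  exact h.not_ge (sInf_le ⟨n, rfl, hn⟩)

lemma moduleDepth_eq_zero {x : N} (hx : x ≠ 0) (hmx : ∀ r ∈ maximalIdeal R, r • x = 0) :
    moduleDepth R N = 0 := by
  by_contra h
  have := subsingleton_ext_of_lt_moduleDepth (R := R) (N := N) (n := 0)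
    (by simpa using pos_iff_ne_zero.2 h)
  let g : (R ⧸ maximalIdeal R) →ₗ[R] N := Submodule.liftQ _ (LinearMap.toSpanSingleton R N x)
    (fun r hr ↦ by simpa using hmx r hr)
  have hg : Ext.mk₀ (ModuleCat.ofHom g) = 0 := Subsingleton.elim _ _
  rw [Ext.mk₀_eq_zero_iff] at hg
  have h1 := LinearMap.congr_fun (congrArg ModuleCat.Hom.hom hg) (Submodule.Quotient.mk 1)
  exact hx ((one_smul R x).symm.trans h1)

lemma hasExtensionProperty_bot_of_hasInjDimLE [IsNoetherianRing R] (hfl : IsFiniteLength R R) {n : ℕ}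
    (hN : hasInjDimLE R n N) : HasExtensionProperty (⊥ : Ideal R) N := by
  intro A B _ _ _ _ hB _ f hf g
  have := hasInjectiveDimensionLE_of_hasInjDimLE n N hN
  have key (M : Type) [AddCommGroup M] [Module R M] :
      (Ideal.ofList ([] : List R) • (⊤ : Submodule R M)) = ⊥ := by simp
  obtain ⟨h, hh⟩ := exists_extension_of_isFiniteLength (rs := []) (M := N) (.nil R R) (by simp)
    (hfl.of_surjective (Submodule.mkQ_surjective _)) (.nil R N) (n + 1) hB (by simp) hf
    ((Submodule.mkQ _).comp g)
  let e := Submodule.quotEquivOfEqBot _ (key N)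
  refine ⟨e.toLinearMap.comp h, ?_⟩
  rw [LinearMap.comp_assoc, hh]
  ext x
  simp [e]

end

section

variable {R : Type} [CommRing R] {M : Type} [AddCommGroup M] [Module R M]

lemma eq_zero_of_forall_localizedModule_smul_eq_zero [Module.Finite R M]
    (hann : ∀ r : R, (∀ x : M, r • x = 0) → r = 0) (T : Submonoid R) (s : Localization T)
    (hs : ∀ w : LocalizedModule T M, s • w = 0) : s = 0 := by
  obtain ⟨r, t, rfl⟩ := IsLocalization.exists_mk'_eq T s
  have h (x : M) : ∃ u : T, u • r • x = 0 := by
    have h1 := hs (LocalizedModule.mk x 1)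
    rw [← Localization.mk_eq_mk', LocalizedModule.mk_smul_mk,
      ← LocalizedModule.zero_mk 1, LocalizedModule.mk_eq] at h1
    simpa using h1
  classical
  choose u hu using h
  obtain ⟨G, hG⟩ := Module.Finite.fg_top (R := R) (M := M)
  have h0 : (∏ x ∈ G, u x : T) * r = 0 := by
    refine hann _ fun x ↦ ?_
    have hx : x ∈ Submodule.span R (G : Set M) := hG ▸ Submodule.mem_top
    induction hx using Submodule.span_induction with
    | mem x hx =>
      rw [← Finset.prod_erase_mul _ _ hx, Submonoid.coe_mul, mul_assoc, mul_smul, mul_smul]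
      exact (congrArg _ (hu x)).trans (smul_zero _)
    | zero => exact smul_zero _
    | add x y _ _ hx hy => rw [smul_add, hx, hy, add_zero]
    | smul a x _ hx => rw [smul_comm, hx, smul_zero]
  exact (IsLocalization.mk'_eq_zero_iff r t).2 ⟨_, h0⟩

variable [IsNoetherianRing R]

lemma exists_apply_notMem_of_isAssociatedPrime [Module.Finite R M] (hM : IsMCM R M)
    (hGor : ∀ p : PrimeSpectrum R, ringKrullDim (Localization.AtPrime p.asIdeal) ≤ (1 : WithBot ℕ∞) →
      ∃ k : ℕ, hasInjDimLE (Localization.AtPrime p.asIdeal) k (Localization.AtPrime p.asIdeal))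
    (hann : ∀ r : R, (∀ x : M, r • x = 0) → r = 0)
    (p : Ideal R) (hp : IsAssociatedPrime p M) : ∃ (π : M →ₗ[R] R) (e : M), π e ∉ p := by
  obtain ⟨_, c, hc⟩ := isAssociatedPrime_iff.1 hp
  have hcmem (r : R) : r ∈ p ↔ r • c = 0 := by rw [hc, Submodule.mem_colon_singleton]; simp
  let ι := LocalizedModule.mkLinearMap p.primeCompl M
  have hc0 : ι c ≠ 0 := by
    intro h
    obtain ⟨u, hu⟩ := (IsLocalizedModule.eq_zero_iff p.primeCompl ι).1 h
    exact u.2 ((hcmem _).2 hu)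
  have hdim := hM ⟨p, inferInstance⟩ ⟨_, _, hc0⟩
  have hdepth : moduleDepth (Localization.AtPrime p) (LocalizedModule p.primeCompl M) = 0 := by
    refine moduleDepth_eq_zero hc0 fun r hr ↦ ?_
    obtain ⟨r, t, rfl⟩ := IsLocalization.exists_mk'_eq p.primeCompl r
    rw [IsLocalization.AtPrime.mk'_mem_maximal_iff _ p] at hr
    rw [← Localization.mk_eq_mk']
    change _ • LocalizedModule.mk c 1 = 0
    rw [LocalizedModule.mk_smul_mk, (hcmem r).1 hr, LocalizedModule.zero_mk]
  dsimp only at hdim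
  rw [hdepth] at hdim
  obtain ⟨k, hk⟩ := hGor ⟨p, inferInstance⟩ (hdim.symm.trans_le (by simp))
  have hArt : IsArtinianRing (Localization.AtPrime p) := by
    rw [isArtinianRing_iff_krullDimLE_zero, Ring.krullDimLE_iff, ← hdim]
    simp
  have hfl := (isArtinianRing_iff_isFiniteLength _).1 hArt
  obtain ⟨π, e, he⟩ := (hasExtensionProperty_bot_of_hasInjDimLE hfl hk).exists_linearMap_apply_eq_one
    hfl (LocalizedModule p.primeCompl M) (by
      rw [isFiniteLength_iff_isNoetherian_isArtinian]
      exact ⟨inferInstance, inferInstance⟩)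
    (eq_zero_of_forall_localizedModule_smul_eq_zero hann _)
  have : Module.FinitePresentation R M := Module.finitePresentation_of_finite R M
  obtain ⟨h, s, hs⟩ := Module.FinitePresentation.exists_lift_of_isLocalizedModule p.primeCompl
    (Algebra.linearMap R (Localization.AtPrime p)) ((π.restrictScalars R).comp ι)
  obtain ⟨⟨e0, t⟩, ht⟩ := IsLocalizedModule.surj p.primeCompl ι e
  refine ⟨h, e0, fun hmem ↦ ?_⟩
  have h1 := LinearMap.congr_fun hs e0
  have h2 : algebraMap R (Localization.AtPrime p) (h e0) =
      algebraMap R (Localization.AtPrime p) (s * t : p.primeCompl) := by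
    refine h1.trans ?_
    change (s : R) • π (ι e0) = _
    rw [← ht, Submonoid.smul_def, ← algebraMap_smul (Localization.AtPrime p) (t : R) e, map_smul,
      he, Algebra.smul_def, smul_eq_mul, mul_one, ← map_mul, Submonoid.coe_mul]
  rw [← IsLocalization.AtPrime.to_map_mem_maximal_iff (Localization.AtPrime p) p, h2,
    IsLocalization.AtPrime.to_map_mem_maximal_iff (Localization.AtPrime p) p] at hmem
  exact (s * t).2 hmem

end

section

variable {R : Type} [CommRing R]

lemma RingTheory.Sequence.IsWeaklyRegular.of_leftInverse (rs : List R) :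
    ∀ {M N : Type} [AddCommGroup M] [Module R M] [AddCommGroup N] [Module R N] (i : M →ₗ[R] N)
      (q : N →ₗ[R] M), q.comp i = LinearMap.id → IsWeaklyRegular N rs → IsWeaklyRegular M rs := by
  induction rs with
  | nil => exact fun _ _ _ _ ↦ .nil R _
  | cons r rs ih =>
    intro M N _ _ _ _ i q hqi hN
    rw [isWeaklyRegular_cons_iff] at hN ⊢
    refine ⟨hN.1.of_injective i fun x y hxy ↦ ?_,
      ih (QuotSMulTop.map r i) (QuotSMulTop.map r q) ?_ hN.2⟩
    · rw [← LinearMap.id_apply (R := R) x, ← hqi, LinearMap.comp_apply, hxy, ← LinearMap.comp_apply,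
        hqi, LinearMap.id_apply]
    · rw [← QuotSMulTop.map_comp, hqi, QuotSMulTop.map_id]

lemma subsingleton_ext_prod {M N : Type} [AddCommGroup M] [Module R M] [AddCommGroup N]
    [Module R N] (X : ModuleCat.{0} R) (i : ℕ) (hM : Subsingleton (Ext X (ModuleCat.of R M) i))
    (hN : Subsingleton (Ext X (ModuleCat.of R N) i)) :
    Subsingleton (Ext X (ModuleCat.of R (M × N)) i) := by
  refine subsingleton_of_forall_eq 0 fun α ↦ ?_
  have h1 : 𝟙 (ModuleCat.of R (M × N)) =
      ModuleCat.ofHom (LinearMap.fst R M N) ≫ ModuleCat.ofHom (LinearMap.inl R M N) +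
      ModuleCat.ofHom (LinearMap.snd R M N) ≫ ModuleCat.ofHom (LinearMap.inr R M N) := by
    ext x <;> simp
  rw [← Ext.comp_mk₀_id α, h1, Ext.mk₀_add, Ext.comp_add, ← Ext.mk₀_comp_mk₀, ← Ext.mk₀_comp_mk₀,
    ← Ext.comp_assoc_of_second_deg_zero, ← Ext.comp_assoc_of_second_deg_zero,
    Subsingleton.elim (α.comp (Ext.mk₀ (ModuleCat.ofHom (LinearMap.fst R M N))) (add_zero i)) 0,
    Subsingleton.elim (α.comp (Ext.mk₀ (ModuleCat.ofHom (LinearMap.snd R M N))) (add_zero i)) 0,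
    Ext.zero_comp, Ext.zero_comp, add_zero]

variable [IsLocalRing R] [IsNoetherianRing R]

lemma exists_isWeaklyRegular_of_subsingleton_ext (n : ℕ) (M : Type) [AddCommGroup M] [Module R M]
    [Module.Finite R M] [Nontrivial M] (h : ∀ i < n,
      Subsingleton (Ext (ModuleCat.of R (R ⧸ maximalIdeal R)) (ModuleCat.of R M) i)) :
    ∃ rs : List R, rs.length = n ∧ (∀ r ∈ rs, r ∈ maximalIdeal R) ∧ IsWeaklyRegular M rs := by
  obtain ⟨rs, h1, h2, h3⟩ := ModuleCat.exists_isRegular_of_exists_subsingleton_ext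
    (maximalIdeal R) n (ModuleCat.of R M)
    (lt_top_iff_ne_top.2 (Submodule.top_ne_ideal_smul_of_le_jacobson_annihilator
      (IsLocalRing.maximalIdeal_le_jacobson _)).symm)
    (ModuleCat.of R (R ⧸ maximalIdeal R))
    (by rw [Module.support_eq_zeroLocus, Ideal.annihilator_quotient]) h
  exact ⟨rs, h1, h2, h3.toIsWeaklyRegular⟩

lemma isArtinianRing_quotient_of_isWeaklyRegular (rs : List R) (hm : ∀ r ∈ rs, r ∈ maximalIdeal R)
    (hrs : IsWeaklyRegular R rs) (hd : ringKrullDim R = rs.length) :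
    IsArtinianRing (R ⧸ Ideal.ofList rs) := by
  have hreg := (IsLocalRing.isRegular_iff_isWeaklyRegular_of_subset_maximalIdeal hm).2 hrs
  have h := ringKrullDim_add_length_eq_ringKrullDim_of_isRegular rs hreg
  rw [isArtinianRing_iff_krullDimLE_zero, Ring.krullDimLE_iff]
  rw [hd] at h
  generalize ringKrullDim (R ⧸ Ideal.ofList rs) = x at h ⊢
  induction x with
  | bot => exact bot_le
  | coe x =>
    induction x with
    | top =>
      exfalso
      revert h
      change ((⊤ + (rs.length : ℕ∞) : ℕ∞) : WithBot ℕ∞) = ((rs.length : ℕ∞) : WithBot ℕ∞) → False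
      intro h
      have := WithBot.coe_injective h
      simp at this
    | coe x =>
      have h1 : ((x + rs.length : ℕ) : WithBot ℕ∞) = (rs.length : ℕ) := by
        rw [← h]; push_cast; rfl
      have h2 : x + rs.length = rs.length := by exact_mod_cast h1
      have : x = 0 := by lia
      simp [this]

omit [IsLocalRing R] in
lemma isFiniteLength_of_isArtinianRing_quotient {I : Ideal R} [IsArtinianRing (R ⧸ I)]
    (M : Type) [AddCommGroup M] [Module R M] [Module.Finite R M] :
    IsFiniteLength R (M ⧸ (I • (⊤ : Submodule R M))) := by
  rw [isFiniteLength_iff_isNoetherian_isArtinian]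
  refine ⟨inferInstance, ?_⟩
  have : Module.Finite (R ⧸ I) (M ⧸ (I • (⊤ : Submodule R M))) :=
    Module.Finite.of_restrictScalars_finite R _ _
  have : IsArtinian (R ⧸ I) (M ⧸ (I • (⊤ : Submodule R M))) := inferInstance
  exact isArtinian_of_surjective_algebraMap (R := R ⧸ I) Ideal.Quotient.mk_surjective

lemma subsingleton_ext_of_isMCM {M : Type} [AddCommGroup M] [Module R M] [Module.Finite R M]
    [Nontrivial M] (hM : IsMCM R M) {d : ℕ} (hd : ringKrullDim R = d) (i : ℕ) (hi : i < d) :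
    Subsingleton (Ext (ModuleCat.of R (R ⧸ maximalIdeal R)) (ModuleCat.of R M) i) := by
  let T := (maximalIdeal R).primeCompl
  have hT : ∀ t ∈ T, IsUnit t := fun t ht ↦ by simpa [T] using ht
  let σ := IsLocalization.atUnits R T hT (S := Localization.AtPrime (maximalIdeal R))
  have hbij : Function.Bijective (LocalizedModule.mkLinearMap T M) := by
    refine ⟨fun x y hxy ↦ ?_, fun y ↦ ?_⟩
    · obtain ⟨t, ht⟩ := (IsLocalizedModule.eq_iff_exists T (LocalizedModule.mkLinearMap T M)).1 hxy
      exact (hT _ t.2).isSMulRegular M ht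
    · obtain ⟨⟨x, t⟩, hx⟩ := IsLocalizedModule.surj T (LocalizedModule.mkLinearMap T M) y
      obtain ⟨u, hu⟩ := hT _ t.2
      refine ⟨(↑u⁻¹ : R) • x, ?_⟩
      rw [map_smul, ← hx, Submonoid.smul_def, ← hu, smul_smul, Units.inv_mul, one_smul]
  let e := LinearEquiv.ofBijective _ hbij
  have : Nontrivial (LocalizedModule T M) := e.symm.toEquiv.nontrivial
  have h1 := hM (closedPoint R) this
  change (moduleDepth (Localization.AtPrime (maximalIdeal R)) (LocalizedModule T M) : WithBot ℕ∞) =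
    ringKrullDim (Localization.AtPrime (maximalIdeal R)) at h1
  rw [← ringKrullDim_eq_of_ringEquiv σ.toRingEquiv, hd] at h1
  have h2 : moduleDepth (Localization.AtPrime (maximalIdeal R)) (LocalizedModule T M) = d :=
    WithBot.coe_injective h1
  obtain ⟨rs, hlen, hm, hreg⟩ := exists_isWeaklyRegular_of_subsingleton_ext d (LocalizedModule T M)
    fun i hi ↦ subsingleton_ext_of_lt_moduleDepth (h2 ▸ Nat.cast_lt.2 hi)
  refine subsingleton_ext_of_isWeaklyRegular (rs.map σ.symm) ?_ (ModuleCat.of R M) ?_ i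
    (by simpa [hlen] using hi)
  · simp only [List.forall_mem_map]
    intro r hr x
    obtain ⟨y, rfl⟩ := Submodule.Quotient.mk_surjective _ x
    refine (Submodule.Quotient.mk_eq_zero _).2 (Ideal.mul_mem_right y _ ?_)
    rw [mem_maximalIdeal, mem_nonunits_iff, MulEquiv.isUnit_map]
    exact hm r hr
  · refine (AddEquiv.isWeaklyRegular_congr (e := e.toAddEquiv) ?_).2 hreg
    rw [List.forall₂_map_left_iff, List.forall₂_same]
    intro r _ x
    change e (_ • x) = _ • e x
    rw [map_smul, ← algebraMap_smul (Localization.AtPrime (maximalIdeal R))]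
    exact congrArg (· • e x) (σ.apply_symm_apply r)

end

section

variable {R : Type} [CommRing R] [IsLocalRing R]

lemma exists_linearMap_residue_of_ne_top {M : Type} [AddCommGroup M] [Module R M]
    [Module.Finite R M] {N : Submodule R M} (hN : N ≠ ⊤) :
    ∃ (l : M →ₗ[R] (R ⧸ maximalIdeal R)) (b : M), N ≤ LinearMap.ker l ∧
      l b = Submodule.Quotient.mk 1 := by
  obtain ⟨K, hK, hle⟩ := (eq_top_or_exists_le_coatom N).resolve_left hN
  have : IsSimpleModule R (M ⧸ K) := isSimpleModule_iff_isCoatom.2 hK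
  obtain ⟨e⟩ := nonempty_linearEquiv_of_isSimpleModule (R := R) (M ⧸ K)
  have hsurj : Function.Surjective (e.symm.toLinearMap.comp K.mkQ) :=
    e.symm.surjective.comp (Submodule.mkQ_surjective K)
  obtain ⟨b, hb⟩ := hsurj (Submodule.Quotient.mk 1)
  refine ⟨_, b, hle.trans fun x hx ↦ ?_, hb⟩
  simpa using hx

/-- A module whose linear forms are symmetric and lift along `R → R / I` is cyclic. -/
lemma exists_span_singleton_eq_top {M : Type} [AddCommGroup M] [Module R M] [Module.Finite R M]
    [Nontrivial M] {I : Ideal R} (hI : I ≠ ⊤)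
    (hfl : IsFiniteLength R (R ⧸ (I • (⊤ : Submodule R R))))
    (hfaith : ∀ r : R, (∀ x : M, r • x ∈ I • (⊤ : Submodule R M)) → r ∈ I)
    (hlift : ∀ f : M →ₗ[R] (R ⧸ (I • (⊤ : Submodule R R))),
      ∃ g : M →ₗ[R] R, (Submodule.mkQ _).comp g = f)
    (hsymm : ∀ (φ : M →ₗ[R] R) (a b : M), φ a • b = φ b • a) :
    ∃ a : M, Submodule.span R {a} = ⊤ := by
  have hI' : I • (⊤ : Submodule R R) = I := by simp
  obtain ⟨y, -, hy0, hmy⟩ := hfl.exists_mem_ne_zero (P := ⊤) (by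
    have : Nontrivial (R ⧸ (I • (⊤ : Submodule R R))) :=
      Submodule.Quotient.nontrivial_iff.2 (by rwa [hI'])
    exact top_ne_bot)
  obtain ⟨r, rfl⟩ := Submodule.Quotient.mk_surjective _ y
  have key (l : M →ₗ[R] (R ⧸ maximalIdeal R)) (a b : M) (ha : l a = 0)
      (hb : l b = Submodule.Quotient.mk 1) : r • a ∈ I • (⊤ : Submodule R M) := by
    obtain ⟨φ, hφ⟩ := hlift ((Submodule.liftQ (maximalIdeal R)
      (LinearMap.toSpanSingleton R _ (Submodule.Quotient.mk r)) hmy).comp l)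
    have h1 : φ a ∈ I := by
      have := LinearMap.congr_fun hφ a
      rw [LinearMap.comp_apply, LinearMap.comp_apply, ha, map_zero, Submodule.mkQ_apply,
        Submodule.Quotient.mk_eq_zero, hI'] at this
      exact this
    have h2 : φ b - r ∈ I := by
      have := LinearMap.congr_fun hφ b
      rw [LinearMap.comp_apply, LinearMap.comp_apply, hb, Submodule.mkQ_apply] at this
      rw [← hI', ← Submodule.Quotient.eq]
      exact this.trans (one_smul R (Submodule.Quotient.mk r : R ⧸ (I • (⊤ : Submodule R R))))
    have h3 : r • a = φ a • b - (φ b - r) • a := by rw [hsymm φ a b]; module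
    rw [h3]
    exact sub_mem (Submodule.smul_mem_smul h1 trivial) (Submodule.smul_mem_smul h2 trivial)
  obtain ⟨l, a, -, ha⟩ := exists_linearMap_residue_of_ne_top (bot_ne_top : (⊥ : Submodule R M) ≠ ⊤)
  refine ⟨a, ?_⟩
  by_contra hne
  obtain ⟨l', b, hle, hb⟩ := exists_linearMap_residue_of_ne_top hne
  have hra := key l' a b (hle (Submodule.mem_span_singleton_self a)) hb
  refine hy0 ((Submodule.Quotient.mk_eq_zero _).2 ?_)
  rw [hI']
  refine hfaith r fun x ↦ ?_
  obtain ⟨s, hs⟩ := Submodule.Quotient.mk_surjective _ (l x)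
  have hx : l (x - s • a) = 0 := by
    rw [map_sub, map_smul, ha, ← hs, ← Submodule.Quotient.mk_smul, smul_eq_mul, mul_one, sub_self]
  have h4 : r • x = r • (x - s • a) + s • r • a := by module
  rw [h4]
  exact add_mem (key l _ a hx ha) (Submodule.smul_mem _ _ hra)

omit [IsLocalRing R] in
lemma subsingleton_ext_of_subsingleton (X : ModuleCat.{0} R) (N : Type) [AddCommGroup N]
    [Module R N] [Subsingleton N] (n : ℕ) : Subsingleton (Ext X (ModuleCat.of R N) n) := by
  refine subsingleton_of_forall_eq 0 fun α ↦ ?_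
  have h : 𝟙 (ModuleCat.of R N) = 0 := by
    ext x; exact Subsingleton.elim (α := N) _ _
  rw [← Ext.comp_mk₀_id α, h, Ext.mk₀_zero, Ext.comp_zero]

end

/-- A Cohen–Macaulay local ring of positive dimension with canonical module `ω`, Gorenstein
in codimension one, such that `Ext^i(ω, R) = 0` for `1 ≤ i ≤ 2d−1`, is Gorenstein
(i.e. `ω ≅ R`). -/
theorem gorenstein_of_ext_canonical_vanishing (R : Type) [CommRing R] [IsNoetherianRing R]
    [IsLocalRing R] (d : ℕ) (hd : ringKrullDim R = d) (hdpos : 0 < d) (hCM : IsCMLocal R)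
    (ω : Type) [AddCommGroup ω] [Module R ω] (hω : IsCanonicalModule R ω)
    (hGor : ∀ p : PrimeSpectrum R, ringKrullDim (Localization.AtPrime p.asIdeal) ≤ (1 : WithBot ℕ∞) →
      ∃ k : ℕ, hasInjDimLE (Localization.AtPrime p.asIdeal) k (Localization.AtPrime p.asIdeal))
    (hext : ∀ i : ℕ, 1 ≤ i → i ≤ 2 * d - 1 → Subsingleton (extGroup R i ω R)) :
    Nonempty (ω ≃ₗ[R] R) := by
  obtain ⟨hfin, hMCM, ⟨n, hn⟩, d', hd', ⟨eω⟩⟩ := hω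
  obtain rfl : d = d' := by exact_mod_cast hd.symm.trans hd'
  obtain ⟨e1⟩ := nonempty_extGroup_linearEquiv R d (R ⧸ maximalIdeal R) ω
  have hnt : Nontrivial ω := by
    by_contra h
    rw [not_nontrivial_iff_subsingleton] at h
    have := subsingleton_ext_of_subsingleton (ModuleCat.of R (R ⧸ maximalIdeal R)) ω d
    exact not_subsingleton (R ⧸ maximalIdeal R) (e1.symm.trans eω).symm.toEquiv.subsingleton
  have hdepth : moduleDepth R R = d := WithBot.coe_injective (hCM.trans hd)
  obtain ⟨rs, rfl, hm, hreg⟩ := exists_isWeaklyRegular_of_subsingleton_ext d (R × ω) fun i hi ↦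
    subsingleton_ext_prod _ i
      (subsingleton_ext_of_lt_moduleDepth (hdepth ▸ Nat.cast_lt.2 hi))
      (subsingleton_ext_of_isMCM hMCM hd i hi)
  have hR : IsWeaklyRegular R rs :=
    hreg.of_leftInverse rs (LinearMap.inl R R ω) (LinearMap.fst R R ω) (by ext; simp)
  have hreg' : IsWeaklyRegular ω rs :=
    hreg.of_leftInverse rs (LinearMap.inr R R ω) (LinearMap.snd R R ω) (by ext; simp)
  set J := Ideal.ofList rs with hJ
  have hJm : J ≤ maximalIdeal R := Ideal.span_le.2 hm
  have hJtop : J • (⊤ : Submodule R R) = J := by simp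
  have hArt : IsArtinianRing (R ⧸ J) := isArtinianRing_quotient_of_isWeaklyRegular rs hm hR hd
  have hfl : IsFiniteLength R (R ⧸ (J • (⊤ : Submodule R R))) :=
    isFiniteLength_of_isArtinianRing_quotient R
  have hflJ : IsFiniteLength R (R ⧸ J) :=
    hfl.of_surjective (f := (Submodule.quotEquivOfEq _ _ hJtop).toLinearMap)
      (Submodule.quotEquivOfEq _ _ hJtop).surjective
  have hE : IsFiniteLength R (ω ⧸ (J • (⊤ : Submodule R ω))) :=
    isFiniteLength_of_isArtinianRing_quotient ω
  have hinj := hasInjectiveDimensionLE_of_hasInjDimLE n ω hn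
  have hEP : HasExtensionProperty J (ω ⧸ (J • (⊤ : Submodule R ω))) :=
    fun A B _ _ _ _ hB hB0 f hf g ↦ exists_extension_of_isFiniteLength hR hm hfl hreg' (n + 1) hB
      (fun r hr ↦ hB0 r (Ideal.subset_span hr)) hf g
  have hJE : ∀ r ∈ J, ∀ e : ω ⧸ (J • (⊤ : Submodule R ω)), r • e = 0 := by
    intro r hr e
    obtain ⟨x, rfl⟩ := Submodule.Quotient.mk_surjective _ e
    exact (Submodule.Quotient.mk_eq_zero _).2 (Submodule.smul_mem_smul hr trivial)
  obtain ⟨e2⟩ := nonempty_linearEquiv_ext (N := R ⧸ maximalIdeal R) hreg' fun r hr x ↦ by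
    obtain ⟨y, rfl⟩ := Submodule.Quotient.mk_surjective _ x
    exact (Submodule.Quotient.mk_eq_zero _).2 (Ideal.mul_mem_right y _ (hm r hr))
  have e3 := e2.trans (e1.symm.trans eω)
  have hfaith (r : R) (hr : ∀ e : ω ⧸ (J • (⊤ : Submodule R ω)), r • e = 0) : r ∈ J :=
    hEP.mem_of_forall_smul_eq_zero hflJ e3.toEquiv.nontrivial hr
  have hend := forall_end_eq_smul_of_isWeaklyRegular rs hm ω hreg'
    (hEP.exists_eq_smul hflJ hJE hE ⟨e3⟩)
  have hann (r : R) (hr : ∀ x : ω, r • x = 0) : r = 0 := by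
    have := annihilator_le_of_isWeaklyRegular rs hm ω ⊥ hreg' bot_le (fun r hr ↦ by
      rw [bot_sup_eq]
      exact hfaith r (Module.mem_annihilator.1 hr))
    exact this (Module.mem_annihilator.2 hr)
  obtain ⟨a, ha⟩ := exists_span_singleton_eq_top
    (ne_top_of_le_ne_top (maximalIdeal.isMaximal R).ne_top hJm) hfl
    (fun r hr ↦ hfaith r fun e ↦ by
      obtain ⟨x, rfl⟩ := Submodule.Quotient.mk_surjective _ e
      exact (Submodule.Quotient.mk_eq_zero _).2 (hr x))
    (exists_lift_of_subsingleton_ext (X := ModuleCat.of R ω) rs (ModuleCat.of R R) hR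
      fun i hi hid ↦ by
        obtain ⟨e⟩ := nonempty_extGroup_linearEquiv R i ω R
        have := hext i hi (by lia)
        exact e.symm.toEquiv.subsingleton)
    (forall_smul_eq_smul_of_exists_apply_notMem hend
      (exists_apply_notMem_of_isAssociatedPrime hMCM hGor hann))
  refine ⟨(LinearEquiv.ofBijective (LinearMap.toSpanSingleton R ω a) ⟨?_, ?_⟩).symm⟩
  · rw [← LinearMap.ker_eq_bot, LinearMap.ker_eq_bot']
    intro r hr
    refine hann r fun x ↦ ?_
    obtain ⟨s, rfl⟩ := Submodule.mem_span_singleton.1 (ha ▸ Submodule.mem_top : x ∈ R ∙ a)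
    rw [smul_comm]
    exact (congrArg (s • ·) hr).trans (smul_zero s)
  · rw [← LinearMap.range_eq_top, ← ha, LinearMap.range_toSpanSingleton]
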